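/- Let (M_n)_{n∈ℕ} ∈ {C1,C2}^ℕ and let f ∈ Δ be such that ⋂_{n≥0} M_{[0,n)} ℝ³_{≥0} = ℝ_{≥0} f. Then dim_ℚ(f) = 3 (i.e., the entries of f are rationally independent) if and only if the sequence (M_n) is primitive. -/

import Mathlib

open Matrix Filter MeasureTheory

noncomputable section

/-- The matrix `C1`. -/
def C1 : Matrix (Fin 3) (Fin 3) ℝ := !![1,1,0; 0,0,1; 0,1,0]

/-- The matrix `C2`. -/
def C2 : Matrix (Fin 3) (Fin 3) ℝ := !![0,1,0; 1,0,0; 0,1,1]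

/-- The product `M 0 * M 1 * ... * M (n-1)`. -/
def pprod (M : ℕ → Matrix (Fin 3) (Fin 3) ℝ) (n : ℕ) : Matrix (Fin 3) (Fin 3) ℝ :=
  ((List.range n).map M).prod

/-- The product `M r * M (r+1) * ... * M (s-1)`. -/
def segProd (M : ℕ → Matrix (Fin 3) (Fin 3) ℝ) (r s : ℕ) : Matrix (Fin 3) (Fin 3) ℝ :=
  ((List.range (s - r)).map (fun k => M (r + k))).prod

/-- A sequence of nonnegative matrices is primitive if every tail has a finite
initial product with all entries positive. -/
def IsPrimitiveSeq (M : ℕ → Matrix (Fin 3) (Fin 3) ℝ) : Prop :=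
  ∀ r : ℕ, ∃ s : ℕ, r < s ∧ ∀ i j, 0 < segProd M r s i j

/-- The image of the nonnegative orthant under `M`. -/
def cone (M : Matrix (Fin 3) (Fin 3) ℝ) : Set (Fin 3 → ℝ) :=
  {y | ∃ x : Fin 3 → ℝ, (∀ i, 0 ≤ x i) ∧ y = M.mulVec x}

/-- The ray generated by `f`. -/
def ray (f : Fin 3 → ℝ) : Set (Fin 3 → ℝ) := {y | ∃ t : ℝ, 0 ≤ t ∧ y = t • f}

/-- The simplex of nonnegative vectors whose entries sum to 1. -/
def simplex : Set (Fin 3 → ℝ) := {x | (∀ i, 0 ≤ x i) ∧ x 0 + x 1 + x 2 = 1}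

/-- The dimension over `ℚ` of the vector space spanned by the entries of `f`. -/
def dimQ (f : Fin 3 → ℝ) : ℕ := Module.finrank ℚ (Submodule.span ℚ (Set.range f))

/-- The sequence `(a n, b n, c n)` of row vectors obtained by multiplying on the right by `C1`
at the times `n` with `w n = true` and by `C2` at the other times. -/
def IsRowOrbit {R : Type*} [Add R] (w : ℕ → Bool) (a b c : ℕ → R) : Prop :=
  ∀ n, (w n = true → a (n + 1) = a n ∧ b (n + 1) = a n + c n ∧ c (n + 1) = b n) ∧
    (w n = false → a (n + 1) = b n ∧ b (n + 1) = a n + c n ∧ c (n + 1) = c n)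

theorem IsRowOrbit.shift {R : Type*} [Add R] {w : ℕ → Bool} {a b c : ℕ → R}
    (h : IsRowOrbit w a b c) (k : ℕ) :
    IsRowOrbit (fun n => w (k + n)) (fun n => a (k + n)) (fun n => b (k + n))
      (fun n => c (k + n)) :=
  fun n => h (k + n)

/-- The triple has a positive and a negative entry. -/
def MixedSign (a b c : ℤ) : Prop := (0 < a ∨ 0 < b ∨ 0 < c) ∧ (a < 0 ∨ b < 0 ∨ c < 0)

/-- Every integral row orbit starting at the given triple, all of whose terms have mixed signs,
is driven by an eventually constant sequence. -/
def ForcesConst (a b c : ℤ) : Prop :=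
  ∀ (w : ℕ → Bool) (A B C : ℕ → ℤ), IsRowOrbit w A B C → A 0 = a → B 0 = b → C 0 = c →
    (∀ n, MixedSign (A n) (B n) (C n)) → ∃ N, ∀ n, w (N + n) = w N

theorem ForcesConst.of_not_mixedSign {a b c : ℤ} (h : ¬ MixedSign a b c) : ForcesConst a b c := by
  intro w A B C _ ha hb hc hm
  exact absurd (hm 0) (by rwa [ha, hb, hc])

theorem ForcesConst.of_step {a b c : ℤ} (h₁ : ForcesConst a (a + c) b)
    (h₂ : ForcesConst b (a + c) c) : ForcesConst a b c := by
  rintro w A B C h rfl rfl rfl hm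
  have key : ∃ N, ∀ n, w (1 + (N + n)) = w (1 + N) := by
    cases hw : w 0
    · obtain ⟨e₁, e₂, e₃⟩ := (h 0).2 hw
      exact h₂ _ _ _ _ (h.shift 1) e₁ e₂ e₃ fun n => hm _
    · obtain ⟨e₁, e₂, e₃⟩ := (h 0).1 hw
      exact h₁ _ _ _ _ (h.shift 1) e₁ e₂ e₃ fun n => hm _
  obtain ⟨N, hN⟩ := key
  exact ⟨1 + N, fun n => by rw [add_assoc, hN]⟩

theorem ForcesConst.neg {a b c : ℤ} (h : ForcesConst a b c) : ForcesConst (-a) (-b) (-c) := by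
  intro w A B C ho ha hb hc hm
  refine h w (fun n => -A n) (fun n => -B n) (fun n => -C n) ?_ (by simp [ha]) (by simp [hb])
    (by simp [hc]) ?_
  · intro n
    refine ⟨fun hw => ?_, fun hw => ?_⟩
    · obtain ⟨e₁, e₂, e₃⟩ := (ho n).1 hw
      simp only [e₁, e₂, e₃]
      exact ⟨trivial, by ring, trivial⟩
    · obtain ⟨e₁, e₂, e₃⟩ := (ho n).2 hw
      simp only [e₁, e₂, e₃]
      exact ⟨trivial, by ring, trivial⟩
  · intro n
    have := hm n
    unfold MixedSign at this ⊢
    omega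

theorem ForcesConst.mirror {a b c : ℤ} (h : ForcesConst a b c) : ForcesConst c b a := by
  intro w A B C ho ha hb hc hm
  obtain ⟨N, hN⟩ := h (fun n => !w n) C B A (fun n => by
      refine ⟨fun hw => ?_, fun hw => ?_⟩
      · obtain ⟨e₁, e₂, e₃⟩ := (ho n).2 (by simpa using hw)
        exact ⟨e₃, by rw [e₂, add_comm], e₁⟩
      · obtain ⟨e₁, e₂, e₃⟩ := (ho n).1 (by simpa using hw)
        exact ⟨e₃, by rw [e₂, add_comm], e₁⟩) hc hb ha (fun n => by
      have := hm n
      unfold MixedSign at this ⊢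
      omega)
  exact ⟨N, fun n => by simpa using hN n⟩

theorem ForcesConst.zero {b c : ℤ} (h₁ : ForcesConst b c c) (h₂ : ForcesConst c b b) :
    ForcesConst 0 b c := by
  intro w A B C ho ha hb hc hm
  by_cases hw : ∀ n, w n = true
  · exact ⟨0, fun n => by rw [hw, hw]⟩
  push Not at hw
  have hk : w (Nat.find hw) = false := by simpa using Nat.find_spec hw
  have hlt : ∀ n < Nat.find hw, w n = true := fun n hn => by simpa using Nat.find_min hw hn
  generalize Nat.find hw = k at hk hlt
  have inv : ∀ n ≤ k, A n = 0 ∧ ((B n = b ∧ C n = c) ∨ (B n = c ∧ C n = b)) := by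
    intro n
    induction n with
    | zero => exact fun _ => ⟨ha, Or.inl ⟨hb, hc⟩⟩
    | succ n ih =>
      intro hn
      obtain ⟨e₁, e₂, e₃⟩ := (ho n).1 (hlt n hn)
      have := ih (by omega)
      rw [e₁, e₂, e₃]
      omega
  obtain ⟨e₁, e₂, e₃⟩ := (ho k).2 hk
  obtain ⟨i₁, i₂⟩ := inv k le_rfl
  have key : ∃ N, ∀ n, w (k + 1 + (N + n)) = w (k + 1 + N) := by
    obtain ⟨i₂, i₃⟩ | ⟨i₂, i₃⟩ := i₂
    · exact h₁ _ _ _ _ (ho.shift (k + 1)) (e₁.trans i₂) (by simp [e₂, i₁, i₃]) (e₃.trans i₃)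
        fun n => hm _
    · exact h₂ _ _ _ _ (ho.shift (k + 1)) (e₁.trans i₂) (by simp [e₂, i₁, i₃]) (e₃.trans i₃)
        fun n => hm _
  obtain ⟨N, hN⟩ := key
  exact ⟨k + 1 + N, fun n => by rw [add_assoc, hN]⟩

theorem forcesConst_of_nonneg_of_pos (a b c : ℤ) (ha : 0 ≤ a) (hb : 0 ≤ b) (hc : 0 < c) :
    ForcesConst a b (-c) := by
  by_cases hab : a = 0 ∧ b = 0
  · exact .of_not_mixedSign (by unfold MixedSign; omega)
  by_cases ha0 : a = 0
  · subst ha0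
    have hb0 : 0 < b := by omega
    refine .zero ?_ ?_
    · simpa using (forcesConst_of_nonneg_of_pos c c b hc.le hc.le hb0).neg.mirror
    · exact (forcesConst_of_nonneg_of_pos b b c hb hb hc).mirror
  have ha1 : 0 < a := by omega
  refine .of_step ?_ ?_
  · by_cases hca : c ≤ a
    · exact .of_not_mixedSign (by unfold MixedSign; omega)
    refine .of_step ?_ ?_
    · simpa [sub_eq_add_neg] using
        forcesConst_of_nonneg_of_pos a (a + b) (c - a) ha (by omega) (by omega)
    · simpa [sub_eq_add_neg] using
        (forcesConst_of_nonneg_of_pos b (a + b) (c - a) hb (by omega) (by omega)).mirror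
  · by_cases hca : c ≤ a
    · exact forcesConst_of_nonneg_of_pos b (a - c) c hb (by omega) hc
    · by_cases hb0 : b = 0
      · exact .of_not_mixedSign (by unfold MixedSign; omega)
      · simpa [sub_eq_add_neg] using
          (forcesConst_of_nonneg_of_pos c (c - a) b hc.le (by omega) (by omega)).neg.mirror
termination_by ((max a b + c).toNat, (if a = 0 then 2 else if a ≤ b then 1 else 0), c.toNat)
decreasing_by
  all_goals
    simp only [Prod.lex_def]
    split_ifs <;> omega

theorem forcesConst (a b c : ℤ) : ForcesConst a b c := by
  have main : ∀ a b c : ℤ, 0 ≤ b → ForcesConst a b c := by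
    intro a b c hb
    by_cases ha : 0 ≤ a
    · by_cases hc : 0 ≤ c
      · exact .of_not_mixedSign (by unfold MixedSign; omega)
      · simpa using forcesConst_of_nonneg_of_pos a b (-c) ha hb (by omega)
    · by_cases hc : 0 ≤ c
      · simpa using (forcesConst_of_nonneg_of_pos c b (-a) hc hb (by omega)).mirror
      · by_cases hb0 : b = 0
        · exact .of_not_mixedSign (by unfold MixedSign; omega)
        refine .of_step ?_ ?_
        · simpa using (forcesConst_of_nonneg_of_pos (-a) (-(a + c)) b (by omega) (by omega)
            (by omega)).neg
        · simpa using (forcesConst_of_nonneg_of_pos (-c) (-(a + c)) b (by omega) (by omega)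
            (by omega)).neg.mirror
  by_cases hb : 0 ≤ b
  · exact main a b c hb
  · simpa using (main (-a) (-b) (-c) (by omega)).neg

/-- If no tail of `w` splits into blocks of two equal letters, then every nonnegative nonzero
row orbit is eventually positive. -/
theorem IsRowOrbit.exists_pos {w : ℕ → Bool} (hw : ∀ r, ∃ k, w (r + 2 * k) ≠ w (r + 2 * k + 1))
    {a b c : ℕ → ℝ} (h : IsRowOrbit w a b c) (ha : ∀ n, 0 ≤ a n)
    (hc : ∀ n, 0 ≤ c n) (h0 : 0 < a 0 ∨ 0 < b 0 ∨ 0 < c 0) :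
    ∃ n, 0 < n ∧ 0 < a n ∧ 0 < b n ∧ 0 < c n := by
  have hex : ∀ (x : Bool) (n : ℕ), ∃ k, w (n + k) = x := by
    intro x n
    by_contra! hx
    obtain ⟨k, hk⟩ := hw n
    have h₁ := hx (2 * k)
    have h₂ := hx (2 * k + 1)
    rw [← add_assoc] at h₂
    revert hk h₁ h₂
    cases x <;> cases w (n + 2 * k) <;> cases w (n + 2 * k + 1) <;> simp
  have hab : ∀ n, 0 < a n → 0 < b n → ∃ n, 0 < n ∧ 0 < a n ∧ 0 < b n ∧ 0 < c n := by
    intro n h₁ h₂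
    have hn := hex true n
    have hk := Nat.find_spec hn
    have hlt : ∀ i < Nat.find hn, w (n + i) = false := fun i hi => by
      simpa using Nat.find_min hn hi
    generalize Nat.find hn = k at hk hlt
    have inv : ∀ i ≤ k, 0 < a (n + i) ∧ 0 < b (n + i) := by
      intro i
      induction i with
      | zero => exact fun _ => ⟨h₁, h₂⟩
      | succ i ih =>
        intro hi
        obtain ⟨e₁, e₂, -⟩ := (h (n + i)).2 (hlt i hi)
        obtain ⟨p₁, p₂⟩ := ih (by omega)
        have := hc (n + i)
        rw [← add_assoc, e₁, e₂]
        exact ⟨p₂, by linarith⟩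
    obtain ⟨e₁, e₂, e₃⟩ := (h (n + k)).1 hk
    obtain ⟨p₁, p₂⟩ := inv k le_rfl
    have := hc (n + k)
    exact ⟨n + k + 1, by omega, by rw [e₁]; exact p₁, by rw [e₂]; linarith, by rw [e₃]; exact p₂⟩
  have hbc : ∀ n, 0 < b n → 0 < c n → ∃ n, 0 < n ∧ 0 < a n ∧ 0 < b n ∧ 0 < c n := by
    intro n h₁ h₂
    have hn := hex false n
    have hk := Nat.find_spec hn
    have hlt : ∀ i < Nat.find hn, w (n + i) = true := fun i hi => by
      simpa using Nat.find_min hn hi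
    generalize Nat.find hn = k at hk hlt
    have inv : ∀ i ≤ k, 0 < b (n + i) ∧ 0 < c (n + i) := by
      intro i
      induction i with
      | zero => exact fun _ => ⟨h₁, h₂⟩
      | succ i ih =>
        intro hi
        obtain ⟨-, e₂, e₃⟩ := (h (n + i)).1 (hlt i hi)
        obtain ⟨p₁, p₂⟩ := ih (by omega)
        have := ha (n + i)
        rw [← add_assoc, e₂, e₃]
        exact ⟨by linarith, p₁⟩
    obtain ⟨e₁, e₂, e₃⟩ := (h (n + k)).2 hk
    obtain ⟨p₁, p₂⟩ := inv k le_rfl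
    have := ha (n + k)
    exact ⟨n + k + 1, by omega, by rw [e₁]; exact p₁, by rw [e₂]; linarith, by rw [e₃]; exact p₂⟩
  have hbpos : ∀ n, 0 < b n → ∃ n, 0 < n ∧ 0 < a n ∧ 0 < b n ∧ 0 < c n := by
    intro n h₁
    have hk := Nat.find_spec (hw n)
    have hlt : ∀ i < Nat.find (hw n), w (n + 2 * i) = w (n + 2 * i + 1) := fun i hi => by
      simpa using Nat.find_min (hw n) hi
    generalize Nat.find (hw n) = k at hk hlt
    have inv : ∀ i ≤ k, 0 < b (n + 2 * i) := by
      intro i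
      induction i with
      | zero => exact fun _ => h₁
      | succ i ih =>
        intro hi
        have heq := hlt i hi
        have p := ih (by omega)
        have q₁ := ha (n + 2 * i)
        have q₃ := hc (n + 2 * i)
        rw [show n + 2 * (i + 1) = n + 2 * i + 1 + 1 by ring]
        cases hx : w (n + 2 * i)
        · obtain ⟨e₁, e₂, e₃⟩ := (h _).2 hx
          obtain ⟨f₁, f₂, f₃⟩ := (h _).2 (heq ▸ hx)
          rw [f₂, e₁, e₃]
          linarith
        · obtain ⟨e₁, e₂, e₃⟩ := (h _).1 hx
          obtain ⟨f₁, f₂, f₃⟩ := (h _).1 (heq ▸ hx)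
          rw [f₂, e₁, e₃]
          linarith
    have p := inv k le_rfl
    have q₁ := ha (n + 2 * k)
    have q₃ := hc (n + 2 * k)
    cases hx : w (n + 2 * k)
    · have hy : w (n + 2 * k + 1) = true := by simpa [hx] using hk
      obtain ⟨e₁, e₂, e₃⟩ := (h _).2 hx
      obtain ⟨f₁, f₂, f₃⟩ := (h _).1 hy
      exact hab (n + 2 * k + 1 + 1) (by rw [f₁, e₁]; exact p) (by rw [f₂, e₁, e₃]; linarith)
    · have hy : w (n + 2 * k + 1) = false := by simpa [hx] using hk
      obtain ⟨e₁, e₂, e₃⟩ := (h _).1 hx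
      obtain ⟨f₁, f₂, f₃⟩ := (h _).2 hy
      exact hbc (n + 2 * k + 1 + 1) (by rw [f₂, e₁, e₃]; linarith) (by rw [f₃, e₃]; exact p)
  obtain h0 | h0 | h0 := h0
  · refine hbpos 1 ?_
    have := hc 0
    cases hx : w 0
    · rw [((h 0).2 hx).2.1]; linarith
    · rw [((h 0).1 hx).2.1]; linarith
  · exact hbpos 0 h0
  · refine hbpos 1 ?_
    have := ha 0
    cases hx : w 0
    · rw [((h 0).2 hx).2.1]; linarith
    · rw [((h 0).1 hx).2.1]; linarith

theorem IsRowOrbit.pos_of_le {w : ℕ → Bool} {a b c : ℕ → ℝ} (h : IsRowOrbit w a b c) {m n : ℕ}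
    (hmn : m ≤ n) (hm : 0 < a m ∧ 0 < b m ∧ 0 < c m) : 0 < a n ∧ 0 < b n ∧ 0 < c n := by
  induction n, hmn using Nat.le_induction with
  | base => exact hm
  | succ n _ ih =>
    obtain ⟨p₁, p₂, p₃⟩ := ih
    cases hx : w n
    · obtain ⟨e₁, e₂, e₃⟩ := (h n).2 hx
      rw [e₁, e₂, e₃]
      exact ⟨p₂, by linarith, p₃⟩
    · obtain ⟨e₁, e₂, e₃⟩ := (h n).1 hx
      rw [e₁, e₂, e₃]
      exact ⟨p₁, by linarith, p₂⟩

/-- The entries of `y` satisfy the recursion `y n = M n *ᵥ y (n + 1)`, where `M n` is `C1` if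
`w n = true` and `C2` otherwise. -/
def IsColumnOrbit (w : ℕ → Bool) (y : ℕ → Fin 3 → ℝ) : Prop :=
  ∀ n, (w n = true → y n 0 = y (n + 1) 0 + y (n + 1) 1 ∧ y n 1 = y (n + 1) 2 ∧
      y n 2 = y (n + 1) 1) ∧
    (w n = false → y n 0 = y (n + 1) 1 ∧ y n 1 = y (n + 1) 0 ∧
      y n 2 = y (n + 1) 1 + y (n + 1) 2)

theorem IsColumnOrbit.exists_ne {w : ℕ → Bool} {y : ℕ → Fin 3 → ℝ} (h : IsColumnOrbit w y)
    (hy : ∀ n i, 0 < y n i) (r : ℕ) : ∃ k, w (r + 2 * k) ≠ w (r + 2 * k + 1) := by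
  by_contra! hw
  have inv : ∀ k : ℕ, y (r + 2 * k) 1 = y r 1 ∧
      y (r + 2 * k) 0 + y (r + 2 * k) 2 ≤ y r 0 + y r 2 - k * y r 1 := by
    intro k
    induction k with
    | zero => simp
    | succ k ih =>
      have heq := hw k
      obtain ⟨i₁, i₂⟩ := ih
      rw [show r + 2 * (k + 1) = r + 2 * k + 1 + 1 by ring]
      push_cast
      have p₀ := hy (r + 2 * k + 1 + 1) 0
      have p₂ := hy (r + 2 * k + 1 + 1) 2
      cases hx : w (r + 2 * k)
      · obtain ⟨e₁, e₂, e₃⟩ := (h _).2 hx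
        obtain ⟨f₁, f₂, f₃⟩ := (h _).2 (heq ▸ hx)
        constructor <;> linarith
      · obtain ⟨e₁, e₂, e₃⟩ := (h _).1 hx
        obtain ⟨f₁, f₂, f₃⟩ := (h _).1 (heq ▸ hx)
        constructor <;> linarith
  obtain ⟨k, hk⟩ := Archimedean.arch (y r 0 + y r 2) (hy r 1)
  rw [nsmul_eq_mul] at hk
  have := (inv k).2
  linarith [hy (r + 2 * k) 0, hy (r + 2 * k) 2]

theorem dimQ_eq_three_iff (f : Fin 3 → ℝ) : dimQ f = 3 ↔
    ∀ a b c : ℤ, (a : ℝ) * f 0 + b * f 1 + c * f 2 = 0 → a = 0 ∧ b = 0 ∧ c = 0 := by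
  have h₁ : dimQ f = 3 ↔ LinearIndependent ℚ f := by
    rw [linearIndependent_iff_card_eq_finrank_span, Fintype.card_fin, eq_comm]
    rfl
  rw [h₁, ← LinearIndependent.iff_fractionRing ℤ ℚ, Fintype.linearIndependent_iff]
  constructor
  · intro h a b c habc
    have := h ![a, b, c] (by simpa [Fin.sum_univ_three] using habc)
    exact ⟨this 0, this 1, this 2⟩
  · intro h g hg
    obtain ⟨h₀, h₁, h₂⟩ := h (g 0) (g 1) (g 2) (by simpa [Fin.sum_univ_three] using hg)
    intro i
    fin_cases i <;> assumption

theorem IsColumnOrbit.dimQ_eq_three {w : ℕ → Bool} {y : ℕ → Fin 3 → ℝ} (h : IsColumnOrbit w y)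
    (h0 : dimQ (y 0) = 3) (n : ℕ) : dimQ (y n) = 3 := by
  induction n with
  | zero => exact h0
  | succ n ih =>
    rw [dimQ_eq_three_iff] at ih ⊢
    intro a b c habc
    cases hx : w n
    · obtain ⟨e₁, e₂, e₃⟩ := (h n).2 hx
      have := ih (b - c) a c (by push_cast; rw [e₁, e₂, e₃]; linarith)
      omega
    · obtain ⟨e₁, e₂, e₃⟩ := (h n).1 hx
      have := ih a c (b - a) (by push_cast; rw [e₁, e₂, e₃]; linarith)
      omega

theorem ne_zero_of_dimQ_eq_three {f : Fin 3 → ℝ} (h : dimQ f = 3) (i : Fin 3) : f i ≠ 0 := by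
  rw [dimQ_eq_three_iff] at h
  intro hi
  fin_cases i
  · simpa using h 1 0 0 (by simpa using hi)
  · simpa using h 0 1 0 (by simpa using hi)
  · simpa using h 0 0 1 (by simpa using hi)

/-- The orbit of an integral row vector under right multiplication by `C1` and `C2`. -/
def intOrbit (w : ℕ → Bool) (a b c : ℤ) : ℕ → ℤ × ℤ × ℤ
  | 0 => (a, b, c)
  | n + 1 =>
    let v := intOrbit w a b c n
    if w n then (v.1, v.1 + v.2.2, v.2.1) else (v.2.1, v.1 + v.2.2, v.2.2)

theorem isRowOrbit_intOrbit (w : ℕ → Bool) (a b c : ℤ) :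
    IsRowOrbit w (fun n => (intOrbit w a b c n).1) (fun n => (intOrbit w a b c n).2.1)
      (fun n => (intOrbit w a b c n).2.2) := by
  intro n
  constructor <;> intro hw <;> simp [intOrbit, hw]

theorem IsColumnOrbit.dimQ_eq_three_of_pos {w : ℕ → Bool} {y : ℕ → Fin 3 → ℝ}
    (h : IsColumnOrbit w y) (hy : ∀ n i, 0 < y n i) : dimQ (y 0) = 3 := by
  rw [dimQ_eq_three_iff]
  intro a b c habc
  by_contra hne
  have ho := isRowOrbit_intOrbit w a b c
  have h0 : intOrbit w a b c 0 = (a, b, c) := rfl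
  generalize intOrbit w a b c = v at ho h0
  have inv : ∀ n, ((v n).1 : ℝ) * y n 0 + (v n).2.1 * y n 1 + (v n).2.2 * y n 2 = 0 ∧
      ¬ ((v n).1 = 0 ∧ (v n).2.1 = 0 ∧ (v n).2.2 = 0) := by
    intro n
    induction n with
    | zero => rw [h0]; exact ⟨habc, hne⟩
    | succ n ih =>
      obtain ⟨i₁, i₂⟩ := ih
      cases hx : w n
      · obtain ⟨e₁, e₂, e₃⟩ := (ho n).2 hx
        obtain ⟨f₁, f₂, f₃⟩ := (h n).2 hx
        dsimp only at e₁ e₂ e₃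
        refine ⟨?_, by omega⟩
        rw [e₁, e₂, e₃]
        rw [f₁, f₂, f₃] at i₁
        push_cast
        linarith
      · obtain ⟨e₁, e₂, e₃⟩ := (ho n).1 hx
        obtain ⟨f₁, f₂, f₃⟩ := (h n).1 hx
        dsimp only at e₁ e₂ e₃
        refine ⟨?_, by omega⟩
        rw [e₁, e₂, e₃]
        rw [f₁, f₂, f₃] at i₁
        push_cast
        linarith
  have hpos : ∀ p q r : ℤ, ∀ n, 0 ≤ p → 0 ≤ q → 0 ≤ r →
      (p : ℝ) * y n 0 + q * y n 1 + r * y n 2 = 0 → p = 0 ∧ q = 0 ∧ r = 0 := by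
    intro p q r n hp hq hr hs
    have hp' : (0 : ℝ) ≤ p := by exact_mod_cast hp
    have hq' : (0 : ℝ) ≤ q := by exact_mod_cast hq
    have hr' : (0 : ℝ) ≤ r := by exact_mod_cast hr
    have m₀ := mul_nonneg hp' (hy n 0).le
    have m₁ := mul_nonneg hq' (hy n 1).le
    have m₂ := mul_nonneg hr' (hy n 2).le
    have z₀ : (p : ℝ) * y n 0 = 0 := by linarith
    have z₁ : (q : ℝ) * y n 1 = 0 := by linarith
    have z₂ : (r : ℝ) * y n 2 = 0 := by linarith
    simpa [(hy n _).ne'] using And.intro z₀ (And.intro z₁ z₂)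
  have hm : ∀ n, MixedSign (v n).1 (v n).2.1 (v n).2.2 := by
    intro n
    obtain ⟨i₁, i₂⟩ := inv n
    have p₁ := fun h₁ h₂ h₃ => hpos (v n).1 (v n).2.1 (v n).2.2 n h₁ h₂ h₃ i₁
    have p₂ := fun h₁ h₂ h₃ => hpos (-(v n).1) (-(v n).2.1) (-(v n).2.2) n h₁ h₂ h₃
      (by push_cast; linarith)
    unfold MixedSign
    by_contra hcon
    rw [not_and_or] at hcon
    obtain hcon | hcon := hcon
    · have := p₂ (by omega) (by omega) (by omega)
      omega
    · have := p₁ (by omega) (by omega) (by omega)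
      omega
  obtain ⟨N, hN⟩ := forcesConst _ _ _ w _ _ _ ho rfl rfl rfl hm
  obtain ⟨k, hk⟩ := h.exists_ne hy N
  exact hk (by rw [add_assoc, hN, hN])

theorem segProd_self (M : ℕ → Matrix (Fin 3) (Fin 3) ℝ) (r : ℕ) : segProd M r r = 1 := by
  simp [segProd]

theorem segProd_succ (M : ℕ → Matrix (Fin 3) (Fin 3) ℝ) (r k : ℕ) :
    segProd M r (r + (k + 1)) = segProd M r (r + k) * M (r + k) := by
  simp [segProd, List.range_succ]

theorem pprod_succ (M : ℕ → Matrix (Fin 3) (Fin 3) ℝ) (n : ℕ) :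
    pprod M (n + 1) = pprod M n * M n := by
  simp [pprod, List.range_succ]

theorem mul_C1_apply (P : Matrix (Fin 3) (Fin 3) ℝ) (i : Fin 3) :
    (P * C1) i 0 = P i 0 ∧ (P * C1) i 1 = P i 0 + P i 2 ∧ (P * C1) i 2 = P i 1 := by
  simp [Matrix.mul_apply, Fin.sum_univ_three, C1]

theorem mul_C2_apply (P : Matrix (Fin 3) (Fin 3) ℝ) (i : Fin 3) :
    (P * C2) i 0 = P i 1 ∧ (P * C2) i 1 = P i 0 + P i 2 ∧ (P * C2) i 2 = P i 2 := by
  simp [Matrix.mul_apply, Fin.sum_univ_three, C2]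

theorem isRowOrbit_segProd {M : ℕ → Matrix (Fin 3) (Fin 3) ℝ} {w : ℕ → Bool}
    (h₁ : ∀ n, w n = true → M n = C1) (h₂ : ∀ n, w n = false → M n = C2) (r : ℕ) (i : Fin 3) :
    IsRowOrbit (fun k => w (r + k)) (fun k => segProd M r (r + k) i 0)
      (fun k => segProd M r (r + k) i 1) (fun k => segProd M r (r + k) i 2) := by
  intro k
  constructor <;> intro hw
  · simpa only [segProd_succ, h₁ _ hw] using mul_C1_apply _ i
  · simpa only [segProd_succ, h₂ _ hw] using mul_C2_apply _ i

theorem segProd_nonneg {M : ℕ → Matrix (Fin 3) (Fin 3) ℝ} (hM : ∀ n, M n = C1 ∨ M n = C2)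
    (r k : ℕ) (i j : Fin 3) : 0 ≤ segProd M r (r + k) i j := by
  induction k generalizing j with
  | zero =>
    rw [add_zero, segProd_self, Matrix.one_apply]
    split_ifs <;> norm_num
  | succ k ih =>
    have q₀ := ih 0
    have q₁ := ih 1
    have q₂ := ih 2
    rw [segProd_succ]
    obtain hk | hk := hM (r + k)
    · rw [hk]
      obtain ⟨e₀, e₁, e₂⟩ := mul_C1_apply (segProd M r (r + k)) i
      fin_cases j
      · exact e₀ ▸ q₀
      · exact e₁ ▸ add_nonneg q₀ q₂
      · exact e₂ ▸ q₁
    · rw [hk]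
      obtain ⟨e₀, e₁, e₂⟩ := mul_C2_apply (segProd M r (r + k)) i
      fin_cases j
      · exact e₀ ▸ q₁
      · exact e₁ ▸ add_nonneg q₀ q₂
      · exact e₂ ▸ q₂

theorem isPrimitiveSeq_of_exists_ne {M : ℕ → Matrix (Fin 3) (Fin 3) ℝ} {w : ℕ → Bool}
    (h₁ : ∀ n, w n = true → M n = C1) (h₂ : ∀ n, w n = false → M n = C2)
    (hw : ∀ r, ∃ k, w (r + 2 * k) ≠ w (r + 2 * k + 1)) : IsPrimitiveSeq M := by
  intro r
  have hM : ∀ n, M n = C1 ∨ M n = C2 := fun n => by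
    cases hx : w n
    · exact Or.inr (h₂ n hx)
    · exact Or.inl (h₁ n hx)
  have key : ∀ i, ∃ k, 0 < k ∧ 0 < segProd M r (r + k) i 0 ∧ 0 < segProd M r (r + k) i 1 ∧
      0 < segProd M r (r + k) i 2 := by
    intro i
    refine (isRowOrbit_segProd h₁ h₂ r i).exists_pos (fun m => ?_)
      (fun _ => segProd_nonneg hM _ _ _ _) (fun _ => segProd_nonneg hM _ _ _ _) ?_
    · simpa only [add_assoc] using hw (r + m)
    · fin_cases i <;> simp [segProd_self]
  choose k hk hpos using key
  refine ⟨r + (k 0 + k 1 + k 2), by have := hk 0; omega, fun i => ?_⟩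
  have hle : k i ≤ k 0 + k 1 + k 2 := by fin_cases i <;> simp <;> omega
  obtain ⟨p₀, p₁, p₂⟩ := (isRowOrbit_segProd h₁ h₂ r i).pos_of_le hle (hpos i)
  intro j
  fin_cases j <;> assumption

theorem isUnit_pprod {M : ℕ → Matrix (Fin 3) (Fin 3) ℝ} (hM : ∀ n, M n = C1 ∨ M n = C2)
    (n : ℕ) : IsUnit (pprod M n) := by
  induction n with
  | zero => simp [pprod]
  | succ n ih =>
    rw [pprod_succ]
    refine ih.mul ?_
    rw [Matrix.isUnit_iff_isUnit_det]
    obtain h | h := hM n <;> rw [h] <;> simp [C1, C2, Matrix.det_fin_three]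

theorem mulVec_segProd {M : ℕ → Matrix (Fin 3) (Fin 3) ℝ} {y : ℕ → Fin 3 → ℝ}
    (hy : ∀ n, y n = M n *ᵥ y (n + 1)) (r k : ℕ) :
    y r = segProd M r (r + k) *ᵥ y (r + k) := by
  induction k with
  | zero => simp [segProd_self]
  | succ k ih => rw [segProd_succ, ← Matrix.mulVec_mulVec, ← add_assoc, ← hy, ← ih]

theorem dimQ_eq_three_iff_primitive
    (M : ℕ → Matrix (Fin 3) (Fin 3) ℝ) (hM : ∀ n, M n = C1 ∨ M n = C2)
    (f : Fin 3 → ℝ) (hf : f ∈ simplex)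
    (hcone : (⋂ n : ℕ, cone (pprod M n)) = ray f) :
    dimQ f = 3 ↔ IsPrimitiveSeq M := by
  classical
  obtain ⟨w, h₁, h₂⟩ : ∃ w : ℕ → Bool, (∀ n, w n = true → M n = C1) ∧
      ∀ n, w n = false → M n = C2 :=
    ⟨fun n => decide (M n = C1), fun n hn => by simpa using hn,
      fun n hn => (hM n).resolve_left (by simpa using hn)⟩
  have hmem : f ∈ ⋂ n : ℕ, cone (pprod M n) := hcone ▸ ⟨1, zero_le_one, (one_smul ℝ f).symm⟩
  choose y hy0 hyf using fun n => Set.mem_iInter.1 hmem n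
  have hrec : ∀ n, y n = M n *ᵥ y (n + 1) := by
    intro n
    refine Matrix.mulVec_injective_of_isUnit (isUnit_pprod hM n) ?_
    rw [Matrix.mulVec_mulVec, ← pprod_succ, ← hyf, ← hyf]
  have hf0 : f = y 0 := by simpa [pprod] using hyf 0
  have horb : IsColumnOrbit w y := by
    intro n
    refine ⟨fun hw => ?_, fun hw => ?_⟩
    · rw [hrec n, h₁ n hw]
      simp [Matrix.mulVec, dotProduct, Fin.sum_univ_three, C1]
    · rw [hrec n, h₂ n hw]
      simp [Matrix.mulVec, dotProduct, Fin.sum_univ_three, C2]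
  constructor
  · intro hd
    have hpos : ∀ n i, 0 < y n i := fun n i =>
      lt_of_le_of_ne (hy0 n i)
        (ne_zero_of_dimQ_eq_three (horb.dimQ_eq_three (hf0 ▸ hd) n) i).symm
    exact isPrimitiveSeq_of_exists_ne h₁ h₂ (horb.exists_ne hpos)
  · intro hp
    rw [hf0]
    refine horb.dimQ_eq_three_of_pos fun r i => ?_
    obtain ⟨s, hrs, hs⟩ := hp r
    obtain ⟨k, rfl⟩ := Nat.exists_eq_add_of_le hrs.le
    have hne : y (r + k) ≠ 0 := by
      intro h0
      have hz := hyf (r + k)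
      rw [h0, Matrix.mulVec_zero] at hz
      have := hf.2
      simp [hz] at this
    obtain ⟨j, hj⟩ := Function.ne_iff.1 hne
    rw [mulVec_segProd hrec r k]
    refine Finset.sum_pos' (fun l _ => mul_nonneg (hs i l).le (hy0 _ l))
      ⟨j, Finset.mem_univ j, mul_pos (hs i j) (lt_of_le_of_ne (hy0 _ j) (Ne.symm hj))⟩
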